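/- arXiv:1304.0667 — 6 statements merged into one kernel-verified Lean document; each statement's English description precedes it below -/
import Mathlib

section
/- Let Λ be a ring, e ∈ Λ an idempotent, and I = Λ(1−e)Λ the two-sided ideal generated by 1−e. Assume that the right Λ-module S = Λ/I is simple. Then for every right Λ-module X of finite length and every submodule Y ⊆ X, the following are equivalent: (i) every composition factor of X/Y is isomorphic to S; (ii) X·I ⊆ Y. In particular, X·I is the smallest submodule Y of X such that every composition factor of X/Y is isomorphic to S. -/
/-- Lemma (Mizuno, Lemma 1.2): for `I = Λ(1-e)Λ` with `Λ/I` a simple right module,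
`X·I` is the smallest submodule `Y` of a finite-length right module `X` such that all
composition factors of `X/Y` are isomorphic to `S = Λ/I`.
Right `Λ`-modules are formalized as modules over `Λᵐᵒᵖ`. -/
theorem every_composition_factor_simple_iff_smul_ideal_le
    (Λ : Type*) [Ring Λ] (e : Λ) (he : IsIdempotentElem e)
    (I : Submodule Λᵐᵒᵖ Λ)
    (hI : I = Submodule.span Λᵐᵒᵖ (Set.range fun l : Λ => l * (1 - e)))
    (hS : IsSimpleModule Λᵐᵒᵖ (Λ ⧸ I))
    (X : Type*) [AddCommGroup X] [Module Λᵐᵒᵖ X]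
    (hX : IsFiniteLength Λᵐᵒᵖ X)
    (Y : Submodule Λᵐᵒᵖ X) :
    (∀ s : CompositionSeries (Submodule Λᵐᵒᵖ (X ⧸ Y)),
        s.head = ⊥ → s.last = ⊤ →
        ∀ i : Fin s.length,
          Nonempty ((↥(s i.succ) ⧸ Submodule.comap (s i.succ).subtype (s i.castSucc))
            ≃ₗ[Λᵐᵒᵖ] (Λ ⧸ I))) ↔
      Submodule.span Λᵐᵒᵖ
        {m : X | ∃ (x : X) (a : Λ), a ∈ I ∧ m = MulOpposite.op a • x} ≤ Y := by
  have two : ∀ (l a : Λ), a ∈ I → l * a ∈ I := by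
    intro l a ha
    subst hI
    induction ha using Submodule.span_induction with
    | mem x hx =>
      obtain ⟨m, rfl⟩ := hx
      refine Submodule.subset_span ⟨l * m, ?_⟩
      simp [mul_assoc]
    | zero => simp
    | add x y _ _ hx hy => rw [mul_add]; exact add_mem hx hy
    | smul r x _ hx =>
      have := Submodule.smul_mem _ r hx
      rw [← mul_smul_comm] at this
      exact this
  have hf : (1 - e) ∈ I := by
    subst hI
    exact Submodule.subset_span ⟨1, by simp⟩
  have killS : ∀ (q : Λ ⧸ I) (a : Λ), a ∈ I → MulOpposite.op a • q = 0 := by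
    intro q a ha
    obtain ⟨l, rfl⟩ := Submodule.Quotient.mk_surjective I q
    rw [← Submodule.Quotient.mk_smul, Submodule.Quotient.mk_eq_zero]
    exact two l a ha
  have hff : (1 - e) * (1 - e) = 1 - e := he.one_sub
  constructor
  · intro h
    obtain ⟨hN, hA⟩ := isFiniteLength_iff_isNoetherian_isArtinian.mp hX
    obtain ⟨s, h0, h1⟩ := exists_compositionSeries_of_isNoetherian_isArtinian Λᵐᵒᵖ (X ⧸ Y)
    have hs := h s h0 h1
    have step : ∀ (i : Fin s.length) (z : X ⧸ Y), z ∈ s i.succ →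
        MulOpposite.op (1 - e) • z ∈ s i.castSucc := by
      intro i z hz
      obtain ⟨φ⟩ := hs i
      have h2 : MulOpposite.op (1 - e) •
          (Submodule.Quotient.mk ⟨z, hz⟩ :
            (↥(s i.succ) ⧸ Submodule.comap (s i.succ).subtype (s i.castSucc))) = 0 := by
        apply φ.injective
        rw [map_smul, map_zero]
        exact killS _ _ hf
      rw [← Submodule.Quotient.mk_smul, Submodule.Quotient.mk_eq_zero] at h2
      exact h2
    have all : ∀ (i : Fin (s.length + 1)) (z : X ⧸ Y), MulOpposite.op (1 - e) • z ∈ s i := by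
      intro i
      induction i using Fin.reverseInduction with
      | last =>
        intro z
        have : s (Fin.last s.length) = ⊤ := h1
        rw [this]; trivial
      | cast i ih =>
        intro z
        have := step i _ (ih z)
        rwa [← mul_smul, ← MulOpposite.op_mul, hff] at this
    have kill : ∀ z : X ⧸ Y, MulOpposite.op (1 - e) • z = 0 := by
      intro z
      have h3 := all 0 z
      have : s 0 = ⊥ := h0
      rw [this] at h3
      exact (Submodule.mem_bot _).mp h3
    rw [Submodule.span_le]
    rintro m ⟨x, a, ha, rfl⟩
    rw [SetLike.mem_coe, ← Submodule.Quotient.mk_eq_zero, Submodule.Quotient.mk_smul]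
    generalize (Submodule.Quotient.mk x : X ⧸ Y) = z
    rw [hI] at ha
    induction ha using Submodule.span_induction with
    | mem x hx =>
      obtain ⟨m, rfl⟩ := hx
      simp only [MulOpposite.op_mul, mul_smul, kill]
    | zero => simp
    | add x y _ _ hx hy => rw [MulOpposite.op_add, add_smul, hx, hy, add_zero]
    | smul r x _ hx =>
      have : MulOpposite.op (r • x) = r * MulOpposite.op x := rfl
      rw [this, mul_smul, hx, smul_zero]
  · intro h s _ _ i
    have hsimp : IsSimpleModule Λᵐᵒᵖ
        (↥(s i.succ) ⧸ Submodule.comap (s i.succ).subtype (s i.castSucc)) :=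
      (covBy_iff_quot_is_simple (s.lt_succ i).le).mp (s.step i)
    have killQ : ∀ (q : ↥(s i.succ) ⧸ Submodule.comap (s i.succ).subtype (s i.castSucc)) (a : Λ),
        a ∈ I → MulOpposite.op a • q = 0 := by
      intro q a ha
      obtain ⟨⟨z, hz⟩, rfl⟩ := Submodule.Quotient.mk_surjective _ q
      have h0 : MulOpposite.op a • z = 0 := by
        obtain ⟨x, rfl⟩ := Submodule.Quotient.mk_surjective _ z
        rw [← Submodule.Quotient.mk_smul, Submodule.Quotient.mk_eq_zero]
        exact h (Submodule.subset_span ⟨x, a, ha, rfl⟩)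
      rw [← Submodule.Quotient.mk_smul]
      have : MulOpposite.op a • (⟨z, hz⟩ : ↥(s i.succ)) = 0 := Subtype.ext h0
      rw [this, Submodule.Quotient.mk_zero]
    obtain ⟨q, hq⟩ := @exists_ne _ (IsSimpleModule.nontrivial Λᵐᵒᵖ
      (↥(s i.succ) ⧸ Submodule.comap (s i.succ).subtype (s i.castSucc))) 0
    let g : Λ →ₗ[Λᵐᵒᵖ] (↥(s i.succ) ⧸ Submodule.comap (s i.succ).subtype (s i.castSucc)) :=
      { toFun := fun l => MulOpposite.op l • q
        map_add' := fun a b => by rw [MulOpposite.op_add, add_smul]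
        map_smul' := fun r a => by
          have : MulOpposite.op (r • a) = r * MulOpposite.op a := rfl
          rw [this, mul_smul]; rfl }
    let G := I.liftQ g (fun a ha => killQ q a ha)
    have hG : G ≠ 0 := by
      intro h0
      apply hq
      have : G (Submodule.Quotient.mk 1) = 0 := by rw [h0]; rfl
      have h2 : G (Submodule.Quotient.mk 1) = MulOpposite.op (1 : Λ) • q := rfl
      rw [h2] at this
      simpa using this
    exact ⟨(LinearEquiv.ofBijective G (LinearMap.bijective_of_ne_zero hG)).symm⟩
end

section
/- Let K be a field, Λ a finite-dimensional self-injective K-algebra, e ∈ Λ a primitive idempotent, and I ⊆ Λ a two-sided ideal. Then the right Λ-module eI is either zero or indecomposable. -/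
/-- Left multiplication by `a` as a map of right `Λ`-modules (i.e. `Λᵐᵒᵖ`-modules). -/
def leftMulLinearMap {Λ : Type*} [Ring Λ] (a : Λ) : Λ →ₗ[Λᵐᵒᵖ] Λ where
  toFun x := a * x
  map_add' x y := mul_add a x y
  map_smul' r x := by
    show a * (x * r.unop) = (a * x) * r.unop
    rw [mul_assoc]

theorem fitting_aux {K : Type*} [Field K] {Λ : Type*} [Ring Λ] [Algebra K Λ]
    [FiniteDimensional K Λ] (y : Λ) :
    ∃ (n : ℕ) (z : Λ), y * z = z * y ∧ IsIdempotentElem (y ^ (n+1) * z) ∧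
      y ^ (n+1) * z * y ^ (n+1) = y ^ (n+1) := by
  have hint : IsIntegral K y := IsIntegral.of_finite K y
  obtain ⟨q, hq, hnd⟩ := Polynomial.exists_eq_pow_rootMultiplicity_mul_and_not_dvd
    (minpoly K y) (minpoly.ne_zero hint) 0
  rw [Polynomial.C_0, sub_zero] at hq hnd
  generalize Polynomial.rootMultiplicity 0 (minpoly K y) = n at hq
  have hc : IsCoprime (Polynomial.X ^ (n+1)) q :=
    ((Polynomial.irreducible_X.coprime_iff_not_dvd).2 hnd).pow_left
  obtain ⟨a, b, hab⟩ := hc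
  have h0 : Polynomial.aeval y (Polynomial.X ^ (n+1) * q) = 0 := by
    have : (Polynomial.X ^ (n+1) * q : Polynomial K) = Polynomial.X * minpoly K y := by
      rw [hq]; ring
    rw [this, map_mul, minpoly.aeval, mul_zero]
  have hX : y ^ (n+1) = Polynomial.aeval y (Polynomial.X ^ (n+1) : Polynomial K) := by simp
  have hy : y ^ (n+1) * Polynomial.aeval y a * y ^ (n+1) = y ^ (n+1) := by
    rw [hX, ← map_mul, ← map_mul]
    have : (Polynomial.X ^ (n+1) * a * Polynomial.X ^ (n+1) : Polynomial K)
        = Polynomial.X ^ (n+1) - b * (Polynomial.X ^ (n+1) * q) := by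
      linear_combination Polynomial.X ^ (n+1) * hab
    rw [this, map_sub, map_mul _ b, h0, mul_zero, sub_zero]
  refine ⟨n, Polynomial.aeval y a, ?_, ?_, hy⟩
  · have h := congrArg (Polynomial.aeval y) (mul_comm (Polynomial.X : Polynomial K) a)
    simpa only [map_mul, Polynomial.aeval_X] using h
  · unfold IsIdempotentElem
    rw [← mul_assoc, hy]

theorem ext_aux {Λ : Type*} [Ring Λ] [Module.Injective Λᵐᵒᵖ Λ]
    (A B : Submodule Λᵐᵒᵖ Λ) (h : A ⊓ B = ⊥) :
    ∃ x : Λ, (∀ a ∈ A, x * a = a) ∧ ∀ b ∈ B, x * b = 0 := by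
  have hinj : Function.Injective (A.subtype.coprod B.subtype) := by
    rw [← LinearMap.ker_eq_bot, LinearMap.ker_coprod_of_disjoint_range]
    · simp
    · simpa [disjoint_iff] using h
  obtain ⟨g, hg⟩ := Module.Injective.out (A.subtype.coprod B.subtype) hinj
    (A.subtype ∘ₗ LinearMap.fst Λᵐᵒᵖ A B)
  have key : ∀ c, g c = g 1 * c := fun c => by
    have := g.map_smul (MulOpposite.op c) 1
    simpa using this
  refine ⟨g 1, fun a ha => ?_, fun b hb => ?_⟩
  · rw [← key]; simpa using hg (⟨a, ha⟩, 0)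
  · rw [← key]; simpa using hg (0, ⟨b, hb⟩)

/-- Lemma (Mizuno, Lemma 2.6): over a finite-dimensional self-injective algebra `Λ`,
for a primitive idempotent `e` and a two-sided ideal `I`, the right module `eI` is
either zero or indecomposable. -/
theorem eI_eq_bot_or_indecomposable
    (K : Type*) [Field K] (Λ : Type*) [Ring Λ] [Algebra K Λ] [FiniteDimensional K Λ]
    [Module.Injective Λᵐᵒᵖ Λ]
    (e : Λ) (he : IsIdempotentElem e) (hne : e ≠ 0)
    (hprim : ∀ e₁ e₂ : Λ, IsIdempotentElem e₁ → IsIdempotentElem e₂ →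
      e₁ * e₂ = 0 → e₂ * e₁ = 0 → e = e₁ + e₂ → e₁ = 0 ∨ e₂ = 0)
    (I : Submodule Λᵐᵒᵖ Λ) (htwo : ∀ l : Λ, ∀ a ∈ I, l * a ∈ I) :
    Submodule.map (leftMulLinearMap e) I = ⊥ ∨
      (Submodule.map (leftMulLinearMap e) I ≠ ⊥ ∧
        ∀ A B : Submodule Λᵐᵒᵖ Λ, A ≤ Submodule.map (leftMulLinearMap e) I →
          B ≤ Submodule.map (leftMulLinearMap e) I → A ⊓ B = ⊥ →
          A ⊔ B = Submodule.map (leftMulLinearMap e) I → A = ⊥ ∨ B = ⊥) := by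
  by_cases hz : Submodule.map (leftMulLinearMap e) I = ⊥
  · exact Or.inl hz
  refine Or.inr ⟨hz, fun A B hA hB hAB _ => ?_⟩
  have hfix : ∀ c ∈ Submodule.map (leftMulLinearMap e) I, e * c = c := by
    rintro _ ⟨c, -, rfl⟩
    change e * (e * c) = e * c
    rw [← mul_assoc, he.eq]
  obtain ⟨x, hxA, hxB⟩ := ext_aux A B hAB
  obtain ⟨y, rfl⟩ : ∃ y, y = e * x * e := ⟨_, rfl⟩
  have hyA : ∀ a ∈ A, (e * x * e) * a = a := fun a ha => by
    rw [mul_assoc, hfix a (hA ha), mul_assoc, hxA a ha, hfix a (hA ha)]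
  have hyB : ∀ b ∈ B, (e * x * e) * b = 0 := fun b hb => by
    rw [mul_assoc, hfix b (hB hb), mul_assoc, hxB b hb, mul_zero]
  have hey : e * (e * x * e) = e * x * e := by rw [← mul_assoc, ← mul_assoc, he.eq]
  have hye : (e * x * e) * e = e * x * e := by rw [mul_assoc, he.eq]
  generalize e * x * e = y at *
  obtain ⟨n, z, hyz, hf, hfy⟩ := fitting_aux (K := K) y
  have hcomm : y ^ (n+1) * z = z * y ^ (n+1) := (Commute.pow_left hyz (n+1)).eq
  have hef : e * (y ^ (n+1) * z) = y ^ (n+1) * z := by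
    rw [pow_succ', ← mul_assoc, ← mul_assoc, hey]
  have hfe : (y ^ (n+1) * z) * e = y ^ (n+1) * z := by
    rw [hcomm, pow_succ, mul_assoc, mul_assoc, hye]
  have hpA : ∀ a ∈ A, ∀ m : ℕ, y ^ m * a = a := fun a ha m => by
    induction m with
    | zero => simp
    | succ m ih => rw [pow_succ, mul_assoc, hyA a ha, ih]
  rcases hprim (y ^ (n+1) * z) (e - y ^ (n+1) * z) hf
      (by unfold IsIdempotentElem; rw [mul_sub, sub_mul, sub_mul, he.eq, hef, hfe, hf.eq]; simp)
      (by rw [mul_sub, hfe, hf.eq, sub_self]) (by rw [sub_mul, hef, hf.eq, sub_self])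
      (by simp) with h | h
  · left
    rw [Submodule.eq_bot_iff]
    intro a ha
    rw [h, zero_mul] at hfy
    rw [← hpA a ha (n+1), ← hfy, zero_mul]
  · right
    rw [Submodule.eq_bot_iff]
    intro b hb
    rw [← hfix b (hB hb), sub_eq_zero.1 h, hcomm, pow_succ, mul_assoc, mul_assoc, hyB b hb,
      mul_zero, mul_zero]
end

section
/- Let K be a field, Λ a finite-dimensional self-injective K-algebra, e ∈ Λ an idempotent, and I ⊆ Λ a two-sided ideal. Then every homomorphism f : (1−e)I → eI of right Λ-modules is given by left multiplication by an element of eΛ(1−e): there exists λ ∈ Λ such that f(x) = (eλ(1−e))·x for all x ∈ (1−e)I. Equivalently, the additive map eΛ(1−e) → Hom_Λ((1−e)I, eI) sending μ to the map x ↦ μx is surjective. -/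
/-- Lemma (Mizuno, Lemma 2.7, second part): over a finite-dimensional self-injective
algebra `Λ`, for an idempotent `e` and a two-sided ideal `I`, every homomorphism
`(1-e)I → eI` of right `Λ`-modules is given by left multiplication by an element of
`eΛ(1-e)`. Right `Λ`-modules are formalized as modules over `Λᵐᵒᵖ`. -/
theorem hom_to_eI_is_left_multiplication
    (K : Type*) [Field K] (Λ : Type*) [Ring Λ] [Algebra K Λ] [FiniteDimensional K Λ]
    [Module.Injective Λᵐᵒᵖ Λ]
    (e : Λ) (he : IsIdempotentElem e)
    (I : Submodule Λᵐᵒᵖ Λ) (htwo : ∀ l : Λ, ∀ a ∈ I, l * a ∈ I)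
    (f : ↥(Submodule.map (leftMulLinearMap (1 - e)) I) →ₗ[Λᵐᵒᵖ]
         ↥(Submodule.map (leftMulLinearMap e) I)) :
    ∃ lam : Λ, ∀ x : ↥(Submodule.map (leftMulLinearMap (1 - e)) I),
      (f x : Λ) = (e * lam * (1 - e)) * (x : Λ) := by
  obtain ⟨h, hh⟩ := Module.Injective.out
    (Submodule.map (leftMulLinearMap (1 - e)) I).subtype
    (Submodule.injective_subtype _)
    ((Submodule.map (leftMulLinearMap e) I).subtype.comp f)
  have key : ∀ y : Λ, h y = h 1 * y := by
    intro y
    have := h.map_smul (MulOpposite.op y) 1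
    simpa using this
  refine ⟨h 1, fun x => ?_⟩
  have h1 : (f x : Λ) = h 1 * (x : Λ) := by
    rw [← key]
    exact (hh x).symm
  have h2 : (1 - e) * (x : Λ) = x := by
    obtain ⟨a, _, ha⟩ := x.2
    have ha' : (1 - e) * a = (x : Λ) := ha
    rw [← ha', ← mul_assoc, he.one_sub.eq]
  have h3 : e * (f x : Λ) = f x := by
    obtain ⟨a, _, ha⟩ := (f x).2
    have ha' : e * a = (f x : Λ) := ha
    rw [← ha', ← mul_assoc, he.eq]
  rw [mul_assoc, h2, mul_assoc, ← h1, h3]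
end

section
/- Let K be a field, Λ a finite-dimensional self-injective K-algebra, e ∈ Λ an idempotent, I = Λ(1−e)Λ, and T ⊆ Λ a two-sided ideal such that I·T ≠ T. Then the right Λ-module eT is not a factor module of any finite direct sum of copies of (1−e)T; that is, for every positive integer d there is no surjective homomorphism of right Λ-modules ((1−e)T)^d → eT. -/
/-- Lemma (Mizuno, Lemma 2.8, core): over a finite-dimensional self-injective algebra `Λ`,
if `T` is a two-sided ideal with `I·T ≠ T` for `I = Λ(1-e)Λ`, then `eT` is not a factor
module of any finite direct sum of copies of `(1-e)T`.
Right `Λ`-modules are formalized as modules over `Λᵐᵒᵖ`. -/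
theorem eT_not_in_Fac_of_IT_ne_T
    (K : Type*) [Field K] (Λ : Type*) [Ring Λ] [Algebra K Λ] [FiniteDimensional K Λ]
    [Module.Injective Λᵐᵒᵖ Λ]
    (e : Λ) (he : IsIdempotentElem e)
    (T : Submodule Λᵐᵒᵖ Λ) (htwo : ∀ l : Λ, ∀ a ∈ T, l * a ∈ T)
    (I : Submodule Λᵐᵒᵖ Λ)
    (hI : I = Submodule.span Λᵐᵒᵖ (Set.range fun l : Λ => l * (1 - e)))
    (hIT : Submodule.span Λᵐᵒᵖ {x : Λ | ∃ a ∈ I, ∃ t ∈ T, x = a * t} ≠ T)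
    (d : ℕ) (hd : 0 < d) :
    ¬ ∃ f : (Fin d → ↥(Submodule.map (leftMulLinearMap (1 - e)) T)) →ₗ[Λᵐᵒᵖ]
              ↥(Submodule.map (leftMulLinearMap e) T),
        Function.Surjective f := by
  rintro ⟨f, hf⟩
  apply hIT
  have hmemI : ∀ a : Λ, a * (1 - e) ∈ I := by
    intro a
    rw [hI]
    exact Submodule.subset_span ⟨a, rfl⟩
  have hprod : ∀ a t : Λ, t ∈ T → a * ((1 - e) * t) ∈
      Submodule.span Λᵐᵒᵖ {x : Λ | ∃ a ∈ I, ∃ t ∈ T, x = a * t} := by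
    intro a t ht
    exact Submodule.subset_span ⟨a * (1 - e), hmemI a, t, ht, (mul_assoc _ _ _).symm⟩
  apply le_antisymm
  · rw [Submodule.span_le]
    rintro x ⟨a, -, t, ht, rfl⟩
    exact htwo a t ht
  · intro t ht
    have hext : ∀ i : Fin d, ∃ h : Λ →ₗ[Λᵐᵒᵖ] Λ,
        ∀ x : ↥(Submodule.map (leftMulLinearMap (1 - e)) T),
          h (x : Λ) = (f (Pi.single i x) : Λ) := by
      intro i
      obtain ⟨h, hh⟩ := Module.Injective.out (R := Λᵐᵒᵖ) (Q := Λ)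
        (Submodule.map (leftMulLinearMap (1 - e)) T).subtype
        (Submodule.injective_subtype _)
        ((Submodule.map (leftMulLinearMap e) T).subtype ∘ₗ f ∘ₗ
          LinearMap.single Λᵐᵒᵖ
            (fun _ : Fin d => ↥(Submodule.map (leftMulLinearMap (1 - e)) T)) i)
      exact ⟨h, fun x => hh x⟩
    choose h hh using hext
    have hmul : ∀ i (x : Λ), h i x = h i 1 * x := by
      intro i x
      have := (h i).map_smul (MulOpposite.op x) 1
      simpa using this
    obtain ⟨v, hv⟩ := hf ⟨e * t, ⟨t, ht, rfl⟩⟩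
    have hsum : e * t = ∑ i, h i 1 * (v i : Λ) := by
      have h1 : f v = ∑ i, f (Pi.single i (v i)) := by
        rw [← map_sum, Finset.univ_sum_single]
      have h2 := congrArg Subtype.val (hv.symm.trans h1)
      rw [Submodule.coe_sum] at h2
      refine h2.trans (Finset.sum_congr rfl fun i _ => ?_)
      rw [← hh, hmul]
    have ht' : t = e * t + 1 * ((1 - e) * t) := by noncomm_ring
    rw [ht']
    refine Submodule.add_mem _ ?_ (hprod 1 t ht)
    rw [hsum]
    refine Submodule.sum_mem _ fun i _ => ?_
    obtain ⟨s, hs, hs'⟩ := (v i).2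
    rw [← hs']
    exact hprod _ s hs
end

section
/- Let K be a field and Λ a finite-dimensional self-injective K-algebra. If T and U are two-sided ideals of Λ that are isomorphic as right Λ-modules, then T = U. -/
theorem aux_two_sided_le
    {Λ : Type*} [Ring Λ] [Module.Injective Λᵐᵒᵖ Λ]
    (T U : Submodule Λᵐᵒᵖ Λ)
    (hT : ∀ l : Λ, ∀ a ∈ T, l * a ∈ T)
    (e : ↥T ≃ₗ[Λᵐᵒᵖ] ↥U) : U ≤ T := by
  intro u hu
  obtain ⟨g, hg⟩ := Module.Injective.out (R := Λᵐᵒᵖ) (Q := Λ) T.subtype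
    T.injective_subtype (U.subtype ∘ₗ e.toLinearMap)
  have h1 := hg (e.symm ⟨u, hu⟩)
  have h2 : ∀ x : Λ, g x = g 1 * x := fun x => by
    have := g.map_smul (MulOpposite.op x) 1
    simpa using this
  rw [h2] at h1
  have h3 : g 1 * (e.symm ⟨u, hu⟩ : Λ) = u := by simpa using h1
  rw [← h3]
  exact hT _ _ (e.symm ⟨u, hu⟩).2

/-- Lemma (Mizuno, Lemma 2.21): over a finite-dimensional self-injective algebra `Λ`,
two-sided ideals which are isomorphic as right `Λ`-modules are equal.
Right `Λ`-modules are formalized as modules over `Λᵐᵒᵖ`. -/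
theorem isomorphic_two_sided_ideals_eq
    (K : Type*) [Field K] (Λ : Type*) [Ring Λ] [Algebra K Λ] [FiniteDimensional K Λ]
    [Module.Injective Λᵐᵒᵖ Λ]
    (T U : Submodule Λᵐᵒᵖ Λ)
    (hT : ∀ l : Λ, ∀ a ∈ T, l * a ∈ T) (hU : ∀ l : Λ, ∀ a ∈ U, l * a ∈ U)
    (h : Nonempty (↥T ≃ₗ[Λᵐᵒᵖ] ↥U)) :
    T = U := by
  obtain ⟨e⟩ := h
  exact le_antisymm (aux_two_sided_le U T hU e.symm) (aux_two_sided_le T U hT e)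
end

section
/- Let K be a field, Λ a finite-dimensional K-algebra, and I ⊆ Λ a two-sided ideal such that Λ/I is simple as a right Λ-module. Let T be a finitely generated right Λ-module admitting a projective presentation P₁ → P₀ → T → 0 with P₀ and P₁ finitely generated projective right Λ-modules such that no nonzero module is simultaneously isomorphic to a direct summand of P₀ and to a direct summand of P₁. Then T·I = T or P₁·I = P₁. -/
theorem aux_surj {Λ : Type*} [Ring Λ] (I : Submodule Λᵐᵒᵖ Λ)
    (hS : IsSimpleModule Λᵐᵒᵖ (Λ ⧸ I)) (M : Type*) [AddCommGroup M] [Module Λᵐᵒᵖ M]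
    [Module.Finite Λᵐᵒᵖ M]
    (h : Submodule.span Λᵐᵒᵖ {m : M | ∃ (x : M) (a : Λ), a ∈ I ∧ m = MulOpposite.op a • x} ≠ ⊤) :
    ∃ p : M →ₗ[Λᵐᵒᵖ] (Λ ⧸ I), Function.Surjective p := by
  obtain ⟨N, hN, hle⟩ := (eq_top_or_exists_le_coatom _).resolve_left h
  have hs : IsSimpleModule Λᵐᵒᵖ (M ⧸ N) := isSimpleModule_iff_isCoatom.mpr hN
  obtain ⟨x, hx⟩ : ∃ x : M, x ∉ N := by
    by_contra! hc
    exact hN.1 (eq_top_iff.mpr fun y _ => hc y)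
  let q : Λ →ₗ[Λᵐᵒᵖ] (M ⧸ N) :=
    { toFun := fun a => N.mkQ (MulOpposite.op a • x)
      map_add' := fun a b => by simp [add_smul]
      map_smul' := fun r a => by
        obtain ⟨r, rfl⟩ := MulOpposite.op_surjective r
        simp [mul_smul] }
  have hq : I ≤ LinearMap.ker q := by
    intro a ha
    rw [LinearMap.mem_ker]
    change N.mkQ (MulOpposite.op a • x) = 0
    rw [Submodule.mkQ_apply, Submodule.Quotient.mk_eq_zero]
    exact hle (Submodule.subset_span ⟨x, a, ha, rfl⟩)
  let r := I.liftQ q hq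
  have hr : r ≠ 0 := by
    intro h0
    apply hx
    have h1 : r (I.mkQ 1) = 0 := by rw [h0]; rfl
    have h2 : r (I.mkQ 1) = N.mkQ (MulOpposite.op (1 : Λ) • x) := rfl
    rw [h2] at h1
    simpa [Submodule.Quotient.mk_eq_zero] using h1
  let e := LinearEquiv.ofBijective r (LinearMap.bijective_of_ne_zero hr)
  exact ⟨e.symm.toLinearMap ∘ₗ N.mkQ, e.symm.surjective.comp N.mkQ_surjective⟩

theorem aux_summand {R : Type*} [Ring R] [IsArtinianRing R] (S P Q : Type*)
    [AddCommGroup S] [Module R S] [Nontrivial S]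
    [AddCommGroup P] [Module R P] [Module.Projective R P]
    [AddCommGroup Q] [Module R Q] [Module.Finite R Q] [Module.Projective R Q]
    (p : P →ₗ[R] S) (hp : Function.Surjective p) (q : Q →ₗ[R] S) (hq : Function.Surjective q) :
    ∃ (A : Submodule R P) (B : Submodule R Q), (∃ A' : Submodule R P, IsCompl A A') ∧
      (∃ B' : Submodule R Q, IsCompl B B') ∧ Nonempty (A ≃ₗ[R] B) ∧ A ≠ ⊥ := by
  obtain ⟨u, hu⟩ := Module.projective_lifting_property p q hp
  obtain ⟨v, hv⟩ := Module.projective_lifting_property q p hq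
  have hu' : ∀ x, p (u x) = q x := fun x => LinearMap.congr_fun hu x
  have hv' : ∀ x, q (v x) = p x := fun x => LinearMap.congr_fun hv x
  let φ : Module.End R Q := v ∘ₗ u
  have hφ : ∀ x, φ x = v (u x) := fun _ => rfl
  have hqφ : ∀ n x, q ((φ ^ n) x) = q x := by
    intro n
    induction n with
    | zero => intro x; simp
    | succ n ih => intro x; rw [pow_succ, Module.End.mul_apply, ih, hφ, hv', hu']
  obtain ⟨n, hn, hn1⟩ := ((LinearMap.eventually_isCompl_ker_pow_range_pow φ).and
    (Filter.eventually_ge_atTop 1)).exists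
  obtain ⟨k, rfl⟩ : ∃ k, n = k + 1 := ⟨n - 1, by omega⟩
  have hinj : ∀ x, φ x = 0 → x ∈ LinearMap.range (φ ^ (k + 1)) → x = 0 := by
    intro x hx hxr
    have : x ∈ LinearMap.ker (φ ^ (k + 1)) := by
      rw [LinearMap.mem_ker, pow_succ, Module.End.mul_apply, hx, map_zero]
    exact Submodule.disjoint_def.mp hn.disjoint x this hxr
  have hsur : ∀ x, ∃ y, (φ ^ (k + 1)) x = (φ ^ (k + 1)) ((φ ^ (k + 1)) y) := by
    intro x
    obtain ⟨a, ha, b, ⟨y, rfl⟩, rfl⟩ := Submodule.mem_sup.mp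
      (hn.sup_eq_top ▸ Submodule.mem_top : x ∈ LinearMap.ker (φ ^ (k + 1)) ⊔ LinearMap.range (φ ^ (k + 1)))
    exact ⟨y, by rw [map_add, LinearMap.mem_ker.mp ha, zero_add]⟩
  set B := LinearMap.range (φ ^ (k + 1)) with hB
  have hinjB : Function.Injective (u.domRestrict B) := by
    rw [← LinearMap.ker_eq_bot, LinearMap.ker_eq_bot']
    intro b hb
    have hb' : u b = 0 := hb
    exact Subtype.ext (hinj b (by rw [hφ, hb', map_zero]) b.2)
  refine ⟨LinearMap.range (u.domRestrict B), B, ⟨LinearMap.ker ((φ ^ (k + 1)) ∘ₗ v), ?_⟩,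
    ⟨_, hn.symm⟩, ⟨(LinearEquiv.ofInjective _ hinjB).symm⟩, ?_⟩
  · constructor
    · rw [Submodule.disjoint_def]
      rintro _ ⟨b, rfl⟩ hb
      have hb' : (φ ^ (k + 1)) (φ b) = 0 := hb
      obtain ⟨c, hc⟩ := b.2
      have h1 : φ (b : Q) = 0 := by
        refine Submodule.disjoint_def.mp hn.disjoint _ (LinearMap.mem_ker.mpr hb') ?_
        refine ⟨φ c, ?_⟩
        rw [← hc, ← Module.End.mul_apply, ← Module.End.mul_apply, ← pow_succ, ← pow_succ']
      have h2 : b = 0 := Subtype.ext (hinj b h1 b.2)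
      rw [h2, map_zero]
    · rw [codisjoint_iff, eq_top_iff]
      intro x _
      obtain ⟨y, hy⟩ := hsur (v x)
      obtain ⟨z, hz⟩ := hsur y
      have key : (φ ^ (k + 1)) (v x) = (φ ^ (k + 1)) (φ ((φ ^ (k + 1)) ((φ ^ k) z))) := by
        rw [hy, hz]
        simp only [← Module.End.mul_apply, ← pow_add, ← pow_succ]
        congr 1
        simp only [← pow_succ', ← pow_add, mul_assoc]
        congr 1
      refine Submodule.mem_sup.mpr ⟨u ((φ ^ (k + 1)) ((φ ^ k) z)), ⟨⟨_, ⟨_, rfl⟩⟩, rfl⟩,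
        x - u ((φ ^ (k + 1)) ((φ ^ k) z)), ?_, by abel⟩
      rw [LinearMap.mem_ker, LinearMap.comp_apply, map_sub, map_sub, key, hφ, sub_self]
  · intro h0
    obtain ⟨s, hs⟩ := exists_ne (0 : S)
    obtain ⟨x, rfl⟩ := hq s
    apply hs
    have h1 : u ((φ ^ (k + 1)) x) = 0 := by
      have : u ((φ ^ (k + 1)) x) ∈ LinearMap.range (u.domRestrict B) := ⟨⟨_, ⟨x, rfl⟩⟩, rfl⟩
      rw [h0] at this
      exact this
    rw [← hqφ (k + 1) x, ← hu', h1, map_zero]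

/-- Lemma (Mizuno, Lemma 2.9, tensor-free form): if `Λ/I` is a simple right module and
`T` has a projective presentation `P₁ → P₀ → T → 0` by finitely generated projectives
sharing no nonzero common direct summand, then `T·I = T` or `P₁·I = P₁`.
Right `Λ`-modules are formalized as modules over `Λᵐᵒᵖ`. -/
theorem TI_eq_T_or_P1I_eq_P1
    (K : Type*) [Field K] (Λ : Type*) [Ring Λ] [Algebra K Λ] [FiniteDimensional K Λ]
    (I : Submodule Λᵐᵒᵖ Λ) (htwo : ∀ l : Λ, ∀ a ∈ I, l * a ∈ I)
    (hS : IsSimpleModule Λᵐᵒᵖ (Λ ⧸ I))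
    (T P₀ P₁ : Type*)
    [AddCommGroup T] [Module Λᵐᵒᵖ T] [Module.Finite Λᵐᵒᵖ T]
    [AddCommGroup P₀] [Module Λᵐᵒᵖ P₀] [Module.Finite Λᵐᵒᵖ P₀] [Module.Projective Λᵐᵒᵖ P₀]
    [AddCommGroup P₁] [Module Λᵐᵒᵖ P₁] [Module.Finite Λᵐᵒᵖ P₁] [Module.Projective Λᵐᵒᵖ P₁]
    (f : P₁ →ₗ[Λᵐᵒᵖ] P₀) (g : P₀ →ₗ[Λᵐᵒᵖ] T)
    (hg : Function.Surjective g) (hfg : LinearMap.range f = LinearMap.ker g)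
    (hsummand : ∀ (A : Submodule Λᵐᵒᵖ P₀) (B : Submodule Λᵐᵒᵖ P₁),
      (∃ A' : Submodule Λᵐᵒᵖ P₀, IsCompl A A') →
      (∃ B' : Submodule Λᵐᵒᵖ P₁, IsCompl B B') →
      Nonempty (↥A ≃ₗ[Λᵐᵒᵖ] ↥B) → A = ⊥) :
    Submodule.span Λᵐᵒᵖ {m : T | ∃ (x : T) (a : Λ), a ∈ I ∧ m = MulOpposite.op a • x} = ⊤ ∨
    Submodule.span Λᵐᵒᵖ {m : P₁ | ∃ (x : P₁) (a : Λ), a ∈ I ∧ m = MulOpposite.op a • x} = ⊤ := by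
  by_contra! hcon
  obtain ⟨h1, h2⟩ := hcon
  obtain ⟨p, hp⟩ := aux_surj I hS T h1
  obtain ⟨q, hq⟩ := aux_surj I hS P₁ h2
  have : IsArtinianRing Λᵐᵒᵖ := IsArtinianRing.of_finite K Λᵐᵒᵖ
  have : Nontrivial (Λ ⧸ I) := IsSimpleModule.nontrivial Λᵐᵒᵖ _
  obtain ⟨A, B, hA, hB, e, hne⟩ := aux_summand (Λ ⧸ I) P₀ P₁ (p ∘ₗ g) (hp.comp hg) q hq
  exact hne (hsummand A B hA hB e)
end
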